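/- arXiv:0812.2967 — 5 statements merged into one kernel-verified Lean document; each statement's English description precedes it below -/
import Mathlib

section
/- Let ν be a probability measure on ℝ with CDF F(t) = ν((−∞,t]), let m ≥ 1 be an integer, and for i = 1, …, m define the quantile points q′_i = inf{t ∈ ℝ : F(t) ≥ i/m}; assume each q′_i is finite. Let q₁, …, q_m be any real numbers satisfying q′_i ≤ q_i, and q_i ≤ q′_{i+1} for i ≤ m−1. Then for every t ∈ ℝ, |(1/m)·#{i : q_i ≤ t} − F(t)| ≤ 2/m. In particular, with m = ⌈2/ε⌉ the multiset {q₁,…,q_m} is an ε-quantization of F. -/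
open MeasureTheory

theorem quant_aux (ν : Measure ℝ) [IsProbabilityMeasure ν] (c t : ℝ)
    (hne : {t : ℝ | c ≤ (ν (Set.Iic t)).toReal}.Nonempty)
    (h : sInf {t : ℝ | c ≤ (ν (Set.Iic t)).toReal} ≤ t) : c ≤ (ν (Set.Iic t)).toReal := by
  have hF : ∀ x, (ν (Set.Iic x)).toReal = ProbabilityTheory.cdf ν x := fun x => by
    rw [ProbabilityTheory.cdf_eq_real]; rfl
  rw [hF]
  have hc : Filter.Tendsto (ProbabilityTheory.cdf ν) (nhdsWithin t (Set.Ioi t))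
      (nhds (ProbabilityTheory.cdf ν t)) :=
    ((ProbabilityTheory.cdf ν).right_continuous t).mono_left
      (nhdsWithin_mono _ Set.Ioi_subset_Ici_self)
  refine ge_of_tendsto hc ?_
  filter_upwards [self_mem_nhdsWithin] with s hs
  obtain ⟨x, hx, hxs⟩ := exists_lt_of_csInf_lt hne (lt_of_le_of_lt h hs)
  have hx' : c ≤ (ν (Set.Iic x)).toReal := hx
  rw [hF] at hx'
  exact hx'.trans ((ProbabilityTheory.cdf ν).mono hxs.le)

/-- deterministic quantile construction.  If `F` is the CDF of a probability
measure `ν` on ℝ, `q′_i = inf {t | F t ≥ i/m}` (for `i = 1, …, m`, each assumed finite,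
i.e. the sets are nonempty and bounded below) and `q_i` are reals with `q′_i ≤ q_i ≤ q′_{i+1}`,
then the empirical CDF of `q₁, …, q_m` is uniformly within `2/m` of `F`; in particular with
`m = ⌈2/ε⌉` the `q_i` form an ε-quantization of `F`.
(Indices: `i : Fin m` corresponds to the 1-based index `i+1`.) -/
theorem quantile_points_eps_quantization (ν : Measure ℝ) [IsProbabilityMeasure ν]
    (m : ℕ) (hm : 1 ≤ m) (q : Fin m → ℝ)
    (hne : ∀ i : Fin m,
      {t : ℝ | ((i : ℕ) + 1 : ℝ) / (m : ℝ) ≤ (ν (Set.Iic t)).toReal}.Nonempty)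
    (hbdd : ∀ i : Fin m,
      BddBelow {t : ℝ | ((i : ℕ) + 1 : ℝ) / (m : ℝ) ≤ (ν (Set.Iic t)).toReal})
    (hlo : ∀ i : Fin m,
      sInf {t : ℝ | ((i : ℕ) + 1 : ℝ) / (m : ℝ) ≤ (ν (Set.Iic t)).toReal} ≤ q i)
    (hhi : ∀ i : Fin m, (i : ℕ) + 1 < m →
      q i ≤ sInf {t : ℝ | ((i : ℕ) + 2 : ℝ) / (m : ℝ) ≤ (ν (Set.Iic t)).toReal}) :
    (∀ t : ℝ,
      |((Finset.univ.filter (fun i => q i ≤ t)).card : ℝ) / (m : ℝ)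
        - (ν (Set.Iic t)).toReal| ≤ 2 / (m : ℝ)) ∧
    (∀ ε : ℝ, 0 < ε → m = ⌈(2 : ℝ) / ε⌉₊ →
      ∀ t : ℝ,
        |((Finset.univ.filter (fun i => q i ≤ t)).card : ℝ) / (m : ℝ)
          - (ν (Set.Iic t)).toReal| ≤ ε) := by
  have hm0 : (0 : ℝ) < m := by exact_mod_cast hm
  have main : ∀ t : ℝ,
      |((Finset.univ.filter (fun i => q i ≤ t)).card : ℝ) / (m : ℝ)
        - (ν (Set.Iic t)).toReal| ≤ 2 / (m : ℝ) := by
    intro t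
    have hF0 : 0 ≤ (ν (Set.Iic t)).toReal := ENNReal.toReal_nonneg
    have hF1 : (ν (Set.Iic t)).toReal ≤ 1 := by
      have := measureReal_le_one (μ := ν) (s := Set.Iic t)
      exact this
    have up := fun i : Fin m => fun h : q i ≤ t =>
      quant_aux ν _ t (hne i) ((hlo i).trans h)
    have lo : ∀ i : Fin m, ((i : ℕ) + 2 : ℝ) / (m : ℝ) ≤ (ν (Set.Iic t)).toReal → q i ≤ t := by
      intro i hi
      have h1 : (i : ℕ) + 2 ≤ m := by
        have : ((i : ℕ) + 2 : ℝ) / (m : ℝ) ≤ 1 := hi.trans hF1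
        rw [div_le_one hm0] at this
        exact_mod_cast this
      refine (hhi i (by omega)).trans (csInf_le ?_ hi)
      have := hbdd ⟨i + 1, by omega⟩
      have e : (((i : ℕ) + 1 : ℕ) : ℝ) + 1 = (i : ℕ) + 2 := by push_cast; ring
      simp only [e] at this
      exact this
    generalize (ν (Set.Iic t)).toReal = F at *
    set k := ⌊(m : ℝ) * F⌋₊ with hk
    have hk1 : (k : ℝ) ≤ m * F := Nat.floor_le (by positivity)
    have hk2 : (m : ℝ) * F < k + 1 := Nat.lt_floor_add_one _
    have hkm : k ≤ m := by
      have : (k : ℝ) ≤ m := hk1.trans (by nlinarith)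
      exact_mod_cast this
    have c1 : (Finset.univ.filter (fun i => q i ≤ t)).card ≤ k := by
      rw [← Finset.card_range k]
      refine Finset.card_le_card_of_injOn (fun i : Fin m => (i : ℕ)) ?_
        (fun a _ b _ h => Fin.ext h)
      intro i hi
      have h := up i (by simpa using hi)
      rw [div_le_iff₀ hm0, mul_comm] at h
      have : (i : ℕ) + 1 ≤ k := Nat.le_floor (by exact_mod_cast h)
      simp only [Finset.coe_range, Set.mem_Iio]
      omega
    have c2 : k - 1 ≤ (Finset.univ.filter (fun i => q i ≤ t)).card := by
      rw [← Fintype.card_fin (k - 1), ← Finset.card_univ]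
      refine Finset.card_le_card_of_injOn
        (fun i : Fin (k - 1) => (⟨i, by omega⟩ : Fin m)) ?_ ?_
      · intro i _
        simp only [Finset.coe_filter, Finset.mem_univ, true_and, Set.mem_setOf_eq]
        apply lo
        rw [div_le_iff₀ hm0, mul_comm]
        have : (i : ℕ) + 2 ≤ k := by omega
        have : ((i : ℕ) : ℝ) + 2 ≤ k := by exact_mod_cast this
        linarith
      · intro a _ b _ h
        simpa [Fin.ext_iff] using h
    generalize (Finset.univ.filter (fun i => q i ≤ t)).card = c at *
    have c1' : (c : ℝ) ≤ k := by exact_mod_cast c1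
    have c2' : (k : ℝ) ≤ c + 1 := by
      have : k ≤ c + 1 := by omega
      exact_mod_cast this
    have e : (c : ℝ) / m - F = (c - m * F) / m := by field_simp
    rw [e, abs_div, abs_of_pos hm0]
    gcongr
    rw [abs_le]
    constructor <;> linarith
  refine ⟨main, fun ε hε hmε t => (main t).trans ?_⟩
  have h : 2 / ε ≤ (m : ℝ) := by rw [hmε]; exact Nat.le_ceil _
  rw [div_le_iff₀ hε] at h
  rw [div_le_iff₀ hm0]
  linarith
end

section
/- Let V be a finite multiset of m real numbers and let s be an integer with 1 ≤ s ≤ m. Then there exists a sub-multiset R ⊆ V with |R| = s (namely, the elements of V of sorted rank ⌈j·m/s⌉ for j = 1, …, s) such that for every t ∈ ℝ, |(1/s)·#{r ∈ R : r ≤ t} − (1/m)·#{v ∈ V : v ≤ t}| ≤ 1/s. Consequently, if the empirical CDF of V is within ε/2 of a nondecreasing function F : ℝ → [0,1] at every t and s ≥ 2/ε, then R is an ε-quantization of F. -/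
theorem aux_count (s m : ℕ) (hm : 0 < m) (hsm : s ≤ m) (k : ℕ) :
    ((Finset.range k).filter (fun i => i * s / m < (i + 1) * s / m)).card = k * s / m := by
  induction k with
  | zero => simp
  | succ k ih =>
    have h1 : k * s / m ≤ (k + 1) * s / m := Nat.div_le_div_right (by nlinarith)
    have h2 : (k + 1) * s / m ≤ k * s / m + 1 := by
      rw [← Nat.add_div_right _ hm]
      exact Nat.div_le_div_right (by nlinarith)
    rw [Finset.range_add_one, Finset.filter_insert]
    split_ifs with h
    · rw [Finset.card_insert_of_notMem (by simp), ih]; omega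
    · rw [ih]; omega

theorem aux_seq (V : Multiset ℝ) : ∃ f : ℕ → ℝ,
    (∀ i j, i ≤ j → j < V.card → f i ≤ f j) ∧ V = (Finset.range V.card).val.map f := by
  have hl : (V.sort (· ≤ ·)).length = V.card := Multiset.length_sort _
  refine ⟨fun i => (V.sort (· ≤ ·)).getD i 0, ?_, ?_⟩
  · intro i j hij hj
    have hp := V.pairwise_sort (· ≤ ·)
    rw [← hl] at hj
    rcases hij.eq_or_lt with rfl | h
    · exact le_rfl
    · have := List.pairwise_iff_getElem.1 hp i j (by omega) hj h
      beta_reduce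
      rw [List.getD_eq_getElem _ _ hj, List.getD_eq_getElem _ _ (h.trans hj)]
      exact this
  · conv_lhs => rw [← Multiset.sort_eq V (· ≤ ·)]
    rw [Finset.range_val, ← hl, Multiset.range, Multiset.map_coe]
    congr 1
    apply List.ext_getElem
    · simp
    · intro n h1 h2
      rw [List.getElem_map, List.getElem_range, List.getD_eq_getElem _ _ h1]

/-- from any finite multiset `V` of `m` reals and any `1 ≤ s ≤ m` one can
extract a sub-multiset `R` of size `s` whose empirical CDF is uniformly within `1/s` of
that of `V`.  Consequently, if the empirical CDF of `V` is within `ε/2` of a nondecreasing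
`F : ℝ → [0,1]` everywhere and `s ≥ 2/ε`, then `R` is an ε-quantization of `F`. -/
theorem exists_sub_multiset_quantization (V : Multiset ℝ) (s : ℕ)
    (hs : 1 ≤ s) (hsm : s ≤ Multiset.card V) :
    ∃ R : Multiset ℝ, R ≤ V ∧ Multiset.card R = s ∧
      (∀ t : ℝ,
        |((R.filter (fun r => r ≤ t)).card : ℝ) / (s : ℝ)
          - ((V.filter (fun v => v ≤ t)).card : ℝ) / (Multiset.card V : ℝ)| ≤ 1 / (s : ℝ)) ∧
      (∀ (F : ℝ → ℝ) (ε : ℝ), 0 < ε → Monotone F → (∀ t, F t ∈ Set.Icc (0 : ℝ) 1) →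
        (∀ t : ℝ,
          |((V.filter (fun v => v ≤ t)).card : ℝ) / (Multiset.card V : ℝ) - F t| ≤ ε / 2) →
        2 / ε ≤ (s : ℝ) →
        ∀ t : ℝ, |((R.filter (fun r => r ≤ t)).card : ℝ) / (s : ℝ) - F t| ≤ ε) := by
  obtain ⟨f, hf, hV⟩ := aux_seq V
  set m := V.card with hm
  have hm0 : 0 < m := by omega
  have hs' : (0:ℝ) < s := by exact_mod_cast hs
  have hm' : (0:ℝ) < m := by exact_mod_cast hm0
  have key : ∃ R : Multiset ℝ, R ≤ V ∧ Multiset.card R = s ∧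
      (∀ t : ℝ,
        |((R.filter (fun r => r ≤ t)).card : ℝ) / (s : ℝ)
          - ((V.filter (fun v => v ≤ t)).card : ℝ) / (m : ℝ)| ≤ 1 / (s : ℝ)) := by
    refine ⟨((Finset.range m).filter (fun i => i * s / m < (i + 1) * s / m)).val.map f,
      ?_, ?_, ?_⟩
    · conv_rhs => rw [hV]
      exact Multiset.map_le_map (Finset.val_le_iff.2 (Finset.filter_subset _ _))
    · rw [Multiset.card_map, Finset.card_val, aux_count s m hm0 hsm, Nat.mul_div_cancel_left _ hm0]
    · intro t
      obtain ⟨c, hcm, hc⟩ : ∃ c ≤ m, ∀ i < m, (f i ≤ t ↔ i < c) := by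
        classical
        have hex : ∃ k, m ≤ k ∨ t < f k := ⟨m, Or.inl le_rfl⟩
        refine ⟨Nat.find hex, Nat.find_min' hex (Or.inl le_rfl), fun i hi => ⟨fun h => ?_, fun h => ?_⟩⟩
        · by_contra hn
          rcases Nat.find_spec hex with h1 | h1
          · omega
          · exact absurd (hf _ i (not_lt.1 hn) hi) (by linarith)
        · have := Nat.find_min hex h
          push Not at this
          exact this.2
      have e1 : (V.filter (fun v => v ≤ t)).card = c := by
        rw [hV, Multiset.filter_map, Multiset.card_map, ← Finset.filter_val, Finset.card_val]
        have : (Finset.range m).filter ((fun v => v ≤ t) ∘ f) = Finset.range c := by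
          ext i
          simp only [Finset.mem_filter, Finset.mem_range, Function.comp]
          constructor
          · rintro ⟨a, b⟩; exact (hc i a).1 b
          · intro a; exact ⟨by omega, (hc i (by omega)).2 a⟩
        rw [this, Finset.card_range]
      have e2 : ((((Finset.range m).filter
          (fun i => i * s / m < (i + 1) * s / m)).val.map f).filter (fun v => v ≤ t)).card
          = c * s / m := by
        rw [Multiset.filter_map, Multiset.card_map, ← Finset.filter_val, Finset.card_val,
          ← aux_count s m hm0 hsm]
        congr 1
        ext i
        simp only [Finset.mem_filter, Finset.mem_range, Function.comp]
        constructor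
        · rintro ⟨⟨a, b⟩, d⟩; exact ⟨(hc i a).1 d, b⟩
        · rintro ⟨a, b⟩; exact ⟨⟨by omega, b⟩, (hc i (by omega)).2 a⟩
      rw [e1, e2]
      have h1 : ((c * s / m : ℕ) : ℝ) * m ≤ c * s := by
        exact_mod_cast Nat.div_mul_le_self (c * s) m
      have h2 : (c * s : ℝ) ≤ ((c * s / m : ℕ) : ℝ) * m + m := by
        have := (Nat.lt_div_mul_add (a := c * s) hm0).le
        exact_mod_cast this
      generalize ((c * s / m : ℕ) : ℝ) = q at *
      have : q / s - c / m = ((q * m - c * s) / m) / s := by field_simp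
      rw [this, abs_div, abs_of_pos hs']
      gcongr
      rw [abs_div, abs_of_pos hm', div_le_one hm', abs_le]
      constructor <;> linarith
  obtain ⟨R, h1, h2, h3⟩ := key
  refine ⟨R, h1, h2, h3, ?_⟩
  intro F ε hε _ _ hF hsε t
  have a := h3 t
  have b := hF t
  have : 1 / (s:ℝ) ≤ ε / 2 := by
    rw [div_le_iff₀ hε] at hsε
    rw [div_le_iff₀ hs']; linarith
  rw [abs_le] at *
  constructor <;> linarith [a.1, a.2, b.1, b.2]
end

section
/- Let θ ∈ [0,1), ε ≥ 0, and let k, m ≥ 1 be integers. Let a₁, …, a_m and b₁, …, b_m be points of ℝ^k with nonnegative coordinates such that for every j and every coordinate i: b_j^{(i)} ≤ a_j^{(i)} and a_j^{(i)} − b_j^{(i)} ≤ θ·a_j^{(i)}. Let F : ℝ^k → [0,1] be isotonic (w ⪯ w′ implies F(w) ≤ F(w′)) and suppose |(1/m)·#{j : a_j ⪯ w} − F(w)| ≤ ε for every w ∈ ℝ^k. Define M(w) = (1/m)·#{j : b_j ⪯ w}. Then for every w ∈ ℝ^k with nonnegative coordinates: F(w) − ε ≤ M(w) and M((1−θ)·w)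 ≤ F(w) + ε, where (1−θ)·w denotes coordinatewise scaling. -/
open Classical

/-- k-variate version of the (ε,θ)-quantization guarantee.  Here `x ≤ w` on
`Fin k → ℝ` is the coordinatewise order `⪯`, each `b j` is a relative θ-approximation of
`a j` with nonnegative coordinates, and `F` is isotonic with values in `[0,1]`. -/
theorem kvariate_eps_theta_quantization (θ ε : ℝ)
    (hθ : θ ∈ Set.Ico (0 : ℝ) 1) (hε : 0 ≤ ε)
    (k m : ℕ) (hk : 1 ≤ k) (hm : 1 ≤ m)
    (a b : Fin m → (Fin k → ℝ))
    (ha : ∀ j i, 0 ≤ a j i) (hb : ∀ j i, 0 ≤ b j i)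
    (hba : ∀ j i, b j i ≤ a j i) (happrox : ∀ j i, a j i - b j i ≤ θ * a j i)
    (F : (Fin k → ℝ) → ℝ) (hF : Monotone F)
    (hF01 : ∀ w, F w ∈ Set.Icc (0 : ℝ) 1)
    (hsample : ∀ w : Fin k → ℝ,
      |((Finset.univ.filter (fun j => a j ≤ w)).card : ℝ) / (m : ℝ) - F w| ≤ ε) :
    ∀ w : Fin k → ℝ, (∀ i, 0 ≤ w i) →
      F w - ε ≤ ((Finset.univ.filter (fun j => b j ≤ w)).card : ℝ) / (m : ℝ) ∧
      ((Finset.univ.filter (fun j => b j ≤ fun i => (1 - θ) * w i)).card : ℝ) / (m : ℝ)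
        ≤ F w + ε := by
  intro w _
  have h := abs_le.mp (hsample w)
  constructor
  · refine le_trans (by linarith [h.1]) (div_le_div_of_nonneg_right (Nat.cast_le.mpr
      (Finset.card_le_card (s := Finset.univ.filter (fun j => a j ≤ w)) ?_)) (Nat.cast_nonneg m))
    intro j hj
    simp only [Finset.mem_filter, Finset.mem_univ, true_and] at hj ⊢
    exact fun i => (hba j i).trans (hj i)
  · refine le_trans (div_le_div_of_nonneg_right (Nat.cast_le.mpr
      (Finset.card_le_card (t := Finset.univ.filter (fun j => a j ≤ w)) ?_)) (Nat.cast_nonneg m))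
      (by linarith [h.2])
    intro j hj
    simp only [Finset.mem_filter, Finset.mem_univ, true_and] at hj ⊢
    intro i
    have h1 : b j i ≤ (1 - θ) * w i := hj i
    have h2 := happrox j i
    have h3 : 0 < 1 - θ := by linarith [hθ.2]
    exact le_of_mul_le_mul_left (by linarith) h3
end

section
/- Let μ₁, …, μₙ be Borel probability measures on ℝ^d, let Q₁, …, Qₙ be nonempty finite subsets of ℝ^d, let f : (ℝ^d)ⁿ → ℝ be measurable, let r ∈ ℝ and ε′ ≥ 0. Suppose that for each index i ∈ {1,…,n} and all points q₁, …, q_{i−1}, q_{i+1}, …, qₙ ∈ ℝ^d, |μ_i({x ∈ ℝ^d : f(q₁,…,q_{i−1},x,q_{i+1},…,qₙ) ≤ r}) − (1/|Q_i|)·#{x ∈ Q_i : f(q₁,…,q_{i−1},x,q_{i+1},…,qₙ) ≤ r}| ≤ ε′. Then |(μ₁ ⊗ ⋯ ⊗ μₙ)({(q₁,…,qₙ) : f(q₁,…,qₙ) ≤ r}) − (1/∏ᵢ|Q_i|)·#{(q₁,…,qₙ) ∈ Q₁×⋯×Qₙ : f(q₁,…,qₙ) ≤ r}| ≤ n·ε′.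 -/
open MeasureTheory Classical

theorem psa_count {E : Type*} (n : ℕ) (Q : Fin (n+1) → Finset E) (S : Set (Fin (n+1) → E)) :
    ((Fintype.piFinset Q).filter (fun q => q ∈ S)).card =
      ∑ x ∈ Q 0, ((Fintype.piFinset (fun i : Fin n => Q i.succ)).filter
        (fun y => (Fin.cons x y : Fin (n+1) → E) ∈ S)).card := by
  rw [← Finset.card_sigma]
  refine Finset.card_nbij' (fun q => ⟨q 0, Fin.tail q⟩) (fun p => Fin.cons p.1 p.2) ?_ ?_ ?_ ?_
  · intro q hq
    simp only [Finset.coe_filter, Fintype.mem_piFinset, Set.mem_ofPred_eq] at hq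
    simp only [Finset.coe_sigma, Set.mem_sigma_iff, Finset.mem_coe, Finset.mem_filter,
      Fintype.mem_piFinset, Fin.cons_self_tail]
    exact ⟨hq.1 0, fun i => hq.1 i.succ, hq.2⟩
  · rintro ⟨x, y⟩ h
    simp only [Finset.coe_sigma, Set.mem_sigma_iff, Finset.mem_coe, Finset.mem_filter,
      Fintype.mem_piFinset] at h
    simp only [Finset.coe_filter, Fintype.mem_piFinset, Set.mem_ofPred_eq]
    exact ⟨fun i => Fin.cases h.1 h.2.1 i, h.2.2⟩
  · intro q _
    exact Fin.cons_self_tail q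
  · rintro ⟨x, y⟩ _
    simp

theorem psa_measure {E : Type*} [MeasurableSpace E] (n : ℕ) (μ : Fin (n+1) → Measure E)
    [∀ i, IsProbabilityMeasure (μ i)] (S : Set (Fin (n+1) → E)) (hS : MeasurableSet S) :
    (Measure.pi μ).real S = ∫ y, (μ 0).real {x | (Fin.cons x y : Fin (n+1) → E) ∈ S}
      ∂(Measure.pi (fun i : Fin n => μ i.succ)) := by
  have hmp := (measurePreserving_piFinSuccAbove μ 0).symm
  have h1 := hmp.measure_preimage hS.nullMeasurableSet
  have hm := hmp.measurable hS
  have hp : (MeasurableEquiv.piFinSuccAbove (fun _ : Fin (n+1) => E) 0).symm ⁻¹' S =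
      {p | (Fin.cons p.1 p.2 : Fin (n+1) → E) ∈ S} := by
    ext p
    have : (MeasurableEquiv.piFinSuccAbove (fun _ : Fin (n+1) => E) 0).symm p
        = (Fin.cons p.1 p.2 : Fin (n+1) → E) := Fin.insertNth_zero' p.1 p.2
    rw [Set.mem_preimage, this]
    rfl
  rw [hp] at h1 hm
  simp only [Fin.succAbove_zero] at h1
  rw [Measure.real, ← h1, Measure.prod_apply_symm hm]
  simp only [Measure.real]
  rw [integral_toReal]
  · rfl
  · exact (measurable_measure_prodMk_right hm).aemeasurable
  · exact Filter.Eventually.of_forall fun y => measure_lt_top _ _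

theorem psa_main {E : Type*} [MeasurableSpace E] (ε : ℝ) (n : ℕ) :
    ∀ (μ : Fin n → Measure E) [∀ i, IsProbabilityMeasure (μ i)]
    (Q : Fin n → Finset E) (_ : ∀ i, (Q i).Nonempty)
    (S : Set (Fin n → E)) (_ : MeasurableSet S)
    (_ : ∀ (i : Fin n) (qs : Fin n → E),
      |(μ i).real {x | Function.update qs i x ∈ S}
        - (((Q i).filter (fun x => Function.update qs i x ∈ S)).card : ℝ)
            / ((Q i).card : ℝ)| ≤ ε),
    |(Measure.pi μ).real S
      - (((Fintype.piFinset Q).filter (fun q => q ∈ S)).card : ℝ)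
          / ((∏ i, (Q i).card : ℕ) : ℝ)| ≤ (n : ℝ) * ε := by
  induction n with
  | zero =>
    intro μ _ Q hQ S hS h
    by_cases hx : (default : Fin 0 → E) ∈ S
    · have : S = Set.univ := by
        ext q; simp [Subsingleton.elim q default, hx]
      subst this
      simp
    · have : S = ∅ := by
        ext q; simp [Subsingleton.elim q default, hx]
      subst this
      simp
  | succ n ih =>
    intro μ _ Q hQ S hS h
    set ν := Measure.pi (fun i : Fin n => μ i.succ) with hν
    have hcons : Measurable (fun p : E × (Fin n → E) => (Fin.cons p.1 p.2 : Fin (n+1) → E)) := by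
      refine measurable_pi_lambda _ fun i => ?_
      refine Fin.cases ?_ (fun j => ?_) i
      · simpa using measurable_fst
      · simp only [Fin.cons_succ]
        exact (measurable_pi_apply j).comp measurable_snd
    have hSx : ∀ x, MeasurableSet {y : Fin n → E | (Fin.cons x y : Fin (n+1) → E) ∈ S} := fun x =>
      (hcons.comp measurable_prodMk_left) hS
    have hc0 : (0:ℝ) < (Q 0).card := by exact_mod_cast (hQ 0).card_pos
    -- step 1
    have hI : ∀ x, Integrable (fun y : Fin n → E =>
        Set.indicator {y : Fin n → E | (Fin.cons x y : Fin (n+1) → E) ∈ S} (fun _ => (1:ℝ)) y) ν :=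
      fun x => (integrable_const (1:ℝ)).indicator (hSx x)
    have hI2 : Integrable (fun y : Fin n → E => (∑ x ∈ Q 0,
        Set.indicator {y : Fin n → E | (Fin.cons x y : Fin (n+1) → E) ∈ S} (fun _ => (1:ℝ)) y)
          / ((Q 0).card : ℝ)) ν :=
      (integrable_finsetSum _ fun x _ => hI x).div_const _
    have hI1 : Integrable (fun y => (μ 0).real {x | (Fin.cons x y : Fin (n+1) → E) ∈ S}) ν := by
      refine Integrable.of_bound (C := 1) ?_ (Filter.Eventually.of_forall fun y => ?_)
      · exact (measurable_measure_prodMk_right (hcons hS)).ennreal_toReal.aestronglyMeasurable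
      · rw [Real.norm_of_nonneg measureReal_nonneg]
        exact measureReal_le_one
    have hA : |(Measure.pi μ).real S - (∑ x ∈ Q 0,
        ν.real {y : Fin n → E | (Fin.cons x y : Fin (n+1) → E) ∈ S}) / ((Q 0).card : ℝ)| ≤ ε := by
      have e2 : (∑ x ∈ Q 0, ν.real {y : Fin n → E | (Fin.cons x y : Fin (n+1) → E) ∈ S})
          / ((Q 0).card : ℝ) = ∫ y, (∑ x ∈ Q 0,
        Set.indicator {y : Fin n → E | (Fin.cons x y : Fin (n+1) → E) ∈ S} (fun _ => (1:ℝ)) y)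
          / ((Q 0).card : ℝ) ∂ν := by
        rw [integral_div, integral_finsetSum _ fun x _ => hI x]
        congr 1
        refine Finset.sum_congr rfl fun x _ => ?_
        rw [integral_indicator_const _ (hSx x)]
        simp
      rw [psa_measure n μ S hS, e2, ← integral_sub hI1 hI2, ← Real.norm_eq_abs]
      refine (norm_integral_le_of_norm_le_const (C := ε)
        (Filter.Eventually.of_forall fun y => ?_)).trans (by simp)
      obtain ⟨x0, _⟩ := hQ 0
      have := h 0 (Fin.cons x0 y)
      simp only [Fin.update_cons_zero] at this
      rw [Real.norm_eq_abs]
      convert this using 4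
      rw [Finset.card_filter]
      push_cast
      refine Finset.sum_congr rfl fun x _ => ?_
      simp [Set.indicator_apply]
    have hB : ∀ x, |ν.real {y : Fin n → E | (Fin.cons x y : Fin (n+1) → E) ∈ S} -
        (((Fintype.piFinset (fun i : Fin n => Q i.succ)).filter
        (fun y => (Fin.cons x y : Fin (n+1) → E) ∈ S)).card : ℝ)
          / ((∏ i : Fin n, (Q i.succ).card : ℕ) : ℝ)| ≤ n * ε := by
      intro x
      refine ih (fun i => μ i.succ) (fun i => Q i.succ) (fun i => hQ _) _ (hSx x) ?_
      intro i qs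
      have := h i.succ (Fin.cons x qs)
      simp only [← Fin.cons_update] at this
      exact this
    have hC : |(∑ x ∈ Q 0, ν.real {y : Fin n → E | (Fin.cons x y : Fin (n+1) → E) ∈ S})
          / ((Q 0).card : ℝ) - (((Fintype.piFinset Q).filter (fun q => q ∈ S)).card : ℝ)
          / ((∏ i, (Q i).card : ℕ) : ℝ)| ≤ n * ε := by
      rw [psa_count, Fin.prod_univ_succ]
      push_cast
      rw [mul_comm, ← div_div, ← sub_div, Finset.sum_div, ← Finset.sum_sub_distrib, abs_div,
        abs_of_pos hc0, div_le_iff₀ hc0]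
      refine (Finset.abs_sum_le_sum_abs _ _).trans ?_
      refine (Finset.sum_le_sum (g := fun _ => n * ε) fun x _ => ?_).trans ?_
      · simpa using hB x
      · simp [mul_comm]
    have := abs_sub_le ((Measure.pi μ).real S) ((∑ x ∈ Q 0,
        ν.real {y : Fin n → E | (Fin.cons x y : Fin (n+1) → E) ∈ S}) / ((Q 0).card : ℝ))
        ((((Fintype.piFinset Q).filter (fun q => q ∈ S)).card : ℝ)
          / ((∏ i, (Q i).card : ℕ) : ℝ))
    push_cast at *
    linarith


/-- if each finite set `Q i` is an ε′-sample of `μ i` with respect to the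
ranges `{x | f(q₁,…,x,…,qₙ) ≤ r}` (over all placements of the other points), then the
fraction of tuples of `Q₁ × ⋯ × Qₙ` with statistic at most `r` approximates the probability
that `f ≤ r` under the product measure `μ₁ ⊗ ⋯ ⊗ μₙ`, up to additive error `n·ε′`. -/
theorem product_sample_approximation (d n : ℕ) (hn : 1 ≤ n)
    (μ : Fin n → Measure (Fin d → ℝ)) [∀ i, IsProbabilityMeasure (μ i)]
    (Q : Fin n → Finset (Fin d → ℝ)) (hQ : ∀ i, (Q i).Nonempty)
    (f : (Fin n → (Fin d → ℝ)) → ℝ) (hf : Measurable f)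
    (r ε' : ℝ) (hε' : 0 ≤ ε')
    (hsample : ∀ (i : Fin n) (qs : Fin n → (Fin d → ℝ)),
      |((μ i) {x | f (Function.update qs i x) ≤ r}).toReal
        - (((Q i).filter (fun x => f (Function.update qs i x) ≤ r)).card : ℝ)
            / ((Q i).card : ℝ)| ≤ ε') :
    |((Measure.pi μ) {q | f q ≤ r}).toReal
      - (((Fintype.piFinset Q).filter (fun q => f q ≤ r)).card : ℝ)
          / ((∏ i, (Q i).card : ℕ) : ℝ)| ≤ (n : ℝ) * ε' := by
  exact psa_main ε' n μ Q hQ {q | f q ≤ r} (measurableSet_le hf measurable_const) hsample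
end

section
/- Let d, n ≥ 1, let μ₁, …, μₙ be Borel probability measures on ℝ^d, and let p̄₁, …, p̄ₙ ∈ ℝ^d be points such that for each i, every closed halfspace of ℝ^d containing p̄_i has μ_i-measure at least 1/(2d+2). Let q̄ ∈ ℝ^d and let u ∈ ℝ^d be a unit vector such that #{i : ⟨q̄, u⟩ ≤ ⟨p̄_i, u⟩} ≥ n/(2d+2). If q₁, …, qₙ are independent random points with q_i distributed according to μ_i, then the probability that ⟨q_i, u⟩ < ⟨q̄, u⟩ holds simultaneously for all i = 1, …, n (i.e., that the hyperplane through q̄ orthogonal to u separates q̄ from all the sampled points on the side of u) is at most (1 − 1/(2d+2))^{⌈n/(2d+2)⌉}. -/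
open MeasureTheory Classical

/-- per-direction center point estimate.  If every closed halfspace
containing `pbar i` has `μ i`-measure at least `1/(2d+2)`, and the unit direction `u`
satisfies `#{i : ⟨qbar,u⟩ ≤ ⟨pbar i,u⟩} ≥ n/(2d+2)`, then for independent points
`q i ~ μ i`, the probability that `⟨q i, u⟩ < ⟨qbar, u⟩` for all `i` is at most
`(1 - 1/(2d+2))^⌈n/(2d+2)⌉`. -/
theorem center_point_direction_bound (d n : ℕ) (hd : 1 ≤ d) (hn : 1 ≤ n)
    (μ : Fin n → Measure (EuclideanSpace ℝ (Fin d)))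
    [∀ i, IsProbabilityMeasure (μ i)]
    (pbar : Fin n → EuclideanSpace ℝ (Fin d))
    (hcenter : ∀ (i : Fin n) (v : EuclideanSpace ℝ (Fin d)) (c : ℝ), v ≠ 0 →
      c ≤ (inner ℝ v (pbar i) : ℝ) →
      1 / (2 * (d : ℝ) + 2) ≤ ((μ i) {x | c ≤ (inner ℝ v x : ℝ)}).toReal)
    (qbar u : EuclideanSpace ℝ (Fin d)) (hu : ‖u‖ = 1)
    (hcount : (n : ℝ) / (2 * (d : ℝ) + 2) ≤
      ((Finset.univ.filter
        (fun i => (inner ℝ qbar u : ℝ) ≤ (inner ℝ (pbar i) u : ℝ))).card : ℝ))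
    (Ω : Type) (mΩ : MeasurableSpace Ω) (P : Measure Ω) [IsProbabilityMeasure P]
    (q : Fin n → Ω → EuclideanSpace ℝ (Fin d))
    (hindep : ProbabilityTheory.iIndepFun q P)
    (hlaw : ∀ i, Measure.map (q i) P = μ i) :
    (P {ω | ∀ i, (inner ℝ (q i ω) u : ℝ) < (inner ℝ qbar u : ℝ)}).toReal ≤
      (1 - 1 / (2 * (d : ℝ) + 2)) ^ ⌈(n : ℝ) / (2 * (d : ℝ) + 2)⌉₊ := by
  have hae : ∀ i, AEMeasurable (q i) P := fun i => by
    by_contra h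
    have h1 := hlaw i
    rw [Measure.map_of_not_aemeasurable h] at h1
    exact IsProbabilityMeasure.ne_zero (μ i) h1.symm
  set A : Set (EuclideanSpace ℝ (Fin d)) :=
    {x | (inner ℝ x u : ℝ) < (inner ℝ qbar u : ℝ)} with hA
  have hAm : MeasurableSet A :=
    measurableSet_lt (by fun_prop) measurable_const
  set S := Finset.univ.filter
        (fun i => (inner ℝ qbar u : ℝ) ≤ (inner ℝ (pbar i) u : ℝ)) with hS
  have hu0 : u ≠ 0 := by
    rintro rfl
    simp at hu
  have hbound : ∀ i ∈ S, (P (q i ⁻¹' A)).toReal ≤ 1 - 1 / (2 * (d : ℝ) + 2) := by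
    intro i hi
    have hi' : (inner ℝ qbar u : ℝ) ≤ (inner ℝ (pbar i) u : ℝ) := by
      simpa [hS] using hi
    rw [← Measure.map_apply_of_aemeasurable (hae i) hAm, hlaw i]
    have h1 := hcenter i u (inner ℝ qbar u) hu0 (by rw [real_inner_comm (pbar i) u]; exact hi')
    have h2 : {x | (inner ℝ qbar u : ℝ) ≤ (inner ℝ u x : ℝ)} = Aᶜ := by
      ext x
      simp [hA, real_inner_comm]
    rw [h2] at h1
    have h3 := probReal_compl_eq_one_sub (μ := μ i) hAm
    simp only [Measure.real] at h3
    linarith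
  have hind := hindep.measure_inter_preimage_eq_mul S (sets := fun _ => A) (fun i _ => hAm)
  have hd0 : (0 : ℝ) < 2 * (d : ℝ) + 2 := by positivity
  have hb1 : 1 / (2 * (d : ℝ) + 2) ≤ 1 := by
    rw [div_le_one hd0]
    have : (0 : ℝ) ≤ d := Nat.cast_nonneg d
    linarith
  have hb0 : 0 ≤ 1 / (2 * (d : ℝ) + 2) := by positivity
  calc (P {ω | ∀ i, (inner ℝ (q i ω) u : ℝ) < (inner ℝ qbar u : ℝ)}).toReal
      ≤ (P (⋂ i ∈ S, q i ⁻¹' A)).toReal := by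
        apply ENNReal.toReal_mono (measure_ne_top _ _)
        apply measure_mono
        intro ω hω
        simp only [Set.mem_iInter]
        intro i _
        exact hω i
    _ = ∏ i ∈ S, (P (q i ⁻¹' A)).toReal := by rw [hind, ENNReal.toReal_prod]
    _ ≤ ∏ i ∈ S, (1 - 1 / (2 * (d : ℝ) + 2)) :=
        Finset.prod_le_prod (fun i _ => ENNReal.toReal_nonneg) hbound
    _ = (1 - 1 / (2 * (d : ℝ) + 2)) ^ S.card := by rw [Finset.prod_const]
    _ ≤ _ := pow_le_pow_of_le_one (by linarith) (by linarith) (Nat.ceil_le.mpr hcount)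
end
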